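/- Let β ∈ {1,2,4} and n ≥ 1 an integer with βn > 2, and set b := 3βn/2 + 2 − β. Then the variance of the Wigner delay time satisfies E[τ_W²] − (E[τ_W])² = 4 / ((n+1)(nβ − 2)), where E denotes expectation with respect to the density (1/Z)∏_{j=1}^n τ_j^{−b} e^{−βn/(2τ_j)} ∏_{1≤j<k≤n}|τ_k−τ_j|^β on (0,∞)^n and τ_W := (1/n)∑_{j=1}^n τ_j. -/

import Mathlib

open MeasureTheory Finset

/-- The β-deformed Vandermonde interaction factor `∏_{j<k} |τ_k - τ_j|^β`. -/
noncomputable def vand (β : ℝ) {n : ℕ} (T : Fin n → ℝ) : ℝ :=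
  ∏ j, ∏ k ∈ Finset.Ioi j, |T k - T j| ^ β

/-- The (unnormalized) joint density `∏_j τ_j^{-b} e^{-βn/(2τ_j)} ∏_{j<k}|τ_k-τ_j|^β`
of the proper delay times. -/
noncomputable def wdW (β b : ℝ) (n : ℕ) (τ : Fin n → ℝ) : ℝ :=
  (∏ j, τ j ^ (-b) * Real.exp (-(β * n / (2 * τ j)))) * vand β τ

/-- Expectation of an observable with respect to the proper delay time density. -/
noncomputable def wdE (β b : ℝ) (n : ℕ) (f : (Fin n → ℝ) → ℝ) : ℝ :=
  (∫ τ in Set.univ.pi (fun _ : Fin n => Set.Ioi (0 : ℝ)), f τ * wdW β b n τ) /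
    ∫ τ in Set.univ.pi (fun _ : Fin n => Set.Ioi (0 : ℝ)), wdW β b n τ


/-- The one-body factor `t^{-b} e^{-κ/(2t)}` of the delay time density. -/
noncomputable def invGammaWeight (κ b t : ℝ) : ℝ := t ^ (-b) * Real.exp (-(κ / (2 * t)))

section OneBody

variable {κ b : ℝ}

lemma measurable_invGammaWeight : Measurable (invGammaWeight κ b) := by
  unfold invGammaWeight; fun_prop

lemma invGammaWeight_pos {t : ℝ} (ht : 0 < t) : 0 < invGammaWeight κ b t := by
  unfold invGammaWeight; positivity

lemma invGammaWeight_zero (hb : 0 < b) : invGammaWeight κ b 0 = 0 := by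
  simp [invGammaWeight, Real.zero_rpow (neg_ne_zero.2 hb.ne')]

lemma hasDerivAt_invGammaWeight {t : ℝ} (ht : 0 < t) :
    HasDerivAt (invGammaWeight κ b) (invGammaWeight κ b t * (-b / t + κ / 2 / t ^ 2)) t := by
  have h1 : HasDerivAt (fun x : ℝ => x ^ (-b)) (-b * t ^ (-b - 1)) t :=
    Real.hasDerivAt_rpow_const (Or.inl ht.ne')
  have h2 : HasDerivAt (fun x : ℝ => -(κ / (2 * x))) (κ / 2 / t ^ 2) t := by
    have := ((hasDerivAt_inv ht.ne').const_mul (-(κ / 2)))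
    refine (this.congr_deriv (by field_simp)).congr_of_eventuallyEq (.of_forall fun x => ?_)
    simp only [div_eq_mul_inv, mul_inv]
    ring
  have h3 := h1.mul h2.exp
  refine h3.congr_deriv ?_
  rw [Real.rpow_sub ht, Real.rpow_one, invGammaWeight]
  field_simp

lemma continuousOn_invGammaWeight (hκ : 0 < κ) (hb : 0 < b) :
    ContinuousOn (invGammaWeight κ b) (Set.Ici 0) := by
  intro t ht
  rcases (Set.mem_Ici.1 ht).eq_or_lt with rfl | ht
  · rw [← continuousWithinAt_Ioi_iff_Ici, ContinuousWithinAt, invGammaWeight_zero hb]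
    have h := (tendsto_rpow_mul_exp_neg_mul_atTop_nhds_zero b (κ / 2) (by positivity)).comp
      (tendsto_inv_nhdsGT_zero (𝕜 := ℝ))
    refine h.congr' ?_
    filter_upwards [self_mem_nhdsWithin] with x hx
    have hx : 0 < x := hx
    simp only [Function.comp, invGammaWeight, Real.inv_rpow hx.le, Real.rpow_neg hx.le]
    congr 2
    field_simp
  · exact (hasDerivAt_invGammaWeight ht).continuousAt.continuousWithinAt

lemma one_add_rpow_mul_invGammaWeight_le (hκ : 0 < κ) {e t : ℝ} (he : 0 ≤ e) (ht : 1 ≤ t) :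
    (1 + t) ^ e * invGammaWeight κ b t ≤ 2 ^ e * t ^ (e - b) := by
  have ht0 : 0 < t := by linarith
  have h1 : (1 + t) ^ e ≤ (2 * t) ^ e := Real.rpow_le_rpow (by linarith) (by linarith) he
  have h2 : invGammaWeight κ b t ≤ t ^ (-b) := by
    unfold invGammaWeight
    refine mul_le_of_le_one_right (by positivity) (Real.exp_le_one_iff.2 ?_)
    have : 0 ≤ κ / (2 * t) := by positivity
    linarith
  calc (1 + t) ^ e * invGammaWeight κ b t ≤ (2 * t) ^ e * t ^ (-b) :=
        mul_le_mul h1 h2 (invGammaWeight_pos ht0).le (by positivity)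
    _ = 2 ^ e * t ^ (e - b) := by
        rw [Real.mul_rpow (by norm_num) ht0.le, mul_assoc, ← Real.rpow_add ht0, sub_eq_add_neg]

lemma continuousOn_one_add_rpow (e : ℝ) :
    ContinuousOn (fun t : ℝ => (1 + t) ^ e) (Set.Ici 0) :=
  ContinuousOn.rpow_const (by fun_prop) fun t ht => Or.inl (by
    have := Set.mem_Ici.1 ht
    positivity)

lemma integrableOn_one_add_rpow_mul_invGammaWeight (hκ : 0 < κ) (hb : 0 < b) {e : ℝ}
    (he : 0 ≤ e) (heb : e - b < -1) :
    IntegrableOn (fun t => (1 + t) ^ e * invGammaWeight κ b t) (Set.Ioi 0) := by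
  have hc : ContinuousOn (fun t => (1 + t) ^ e * invGammaWeight κ b t) (Set.Ici 0) :=
    (continuousOn_one_add_rpow e).mul (continuousOn_invGammaWeight hκ hb)
  rw [← Set.Ioc_union_Ioi_eq_Ioi zero_le_one]
  refine IntegrableOn.union ?_ ?_
  · exact ((hc.mono Set.Icc_subset_Ici_self).integrableOn_Icc).mono_set Set.Ioc_subset_Icc_self
  · refine Integrable.mono' ((integrableOn_Ioi_rpow_of_lt heb one_pos).const_mul (2 ^ e)) ?_ ?_
    · exact (hc.mono (fun x (hx : 1 < x) => Set.mem_Ici.2 (by linarith))).aestronglyMeasurable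
        measurableSet_Ioi
    · filter_upwards [ae_restrict_mem measurableSet_Ioi] with t ht
      have ht : 1 < t := ht
      have h0 := invGammaWeight_pos (κ := κ) (b := b) (t := t) (by linarith)
      rw [Real.norm_of_nonneg (by positivity)]
      exact one_add_rpow_mul_invGammaWeight_le hκ he ht.le

lemma tendsto_one_add_rpow_mul_invGammaWeight (hκ : 0 < κ) {e : ℝ}
    (he : 0 ≤ e) (heb : e < b) :
    Filter.Tendsto (fun t => (1 + t) ^ e * invGammaWeight κ b t) Filter.atTop (nhds 0) := by
  have h := (tendsto_rpow_neg_atTop (sub_pos.2 heb)).const_mul ((2 : ℝ) ^ e)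
  rw [mul_zero] at h
  refine squeeze_zero' ?_ ?_ h
  · filter_upwards [Filter.eventually_gt_atTop 0] with t ht
    have := invGammaWeight_pos (κ := κ) (b := b) ht
    positivity
  · filter_upwards [Filter.eventually_ge_atTop 1] with t ht
    rw [neg_sub]
    exact one_add_rpow_mul_invGammaWeight_le hκ he ht

end OneBody

lemma integral_Ioi_deriv_eq_zero_off_countable {f f' : ℝ → ℝ} {a : ℝ} {s : Set ℝ}
    (hs : s.Countable) (hc : ContinuousOn f (Set.Ici a)) (ha : f a = 0)
    (hd : ∀ x ∈ Set.Ioi a \ s, HasDerivAt f (f' x) x)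
    (hi : IntegrableOn f' (Set.Ioi a)) (htop : Filter.Tendsto f Filter.atTop (nhds 0)) :
    ∫ x in Set.Ioi a, f' x = 0 := by
  refine tendsto_nhds_unique (intervalIntegral_tendsto_integral_Ioi a hi Filter.tendsto_id)
    (htop.congr' ?_)
  filter_upwards [Filter.eventually_ge_atTop a] with R hR
  rw [id, integral_eq_of_hasDerivAt_off_countable_of_le f f' hR hs
    (hc.mono Set.Icc_subset_Ici_self) (fun x hx => hd x ⟨hx.1.1, hx.2⟩), ha, sub_zero]
  rw [intervalIntegrable_iff_integrableOn_Ioc_of_le hR]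
  exact hi.mono_set Set.Ioc_subset_Ioi_self

section Vandermonde

variable {β : ℝ}

lemma vand_nonneg {n : ℕ} (T : Fin n → ℝ) : 0 ≤ vand β T :=
  prod_nonneg fun _ _ => prod_nonneg fun _ _ => Real.rpow_nonneg (abs_nonneg _) _

lemma measurable_vand {n : ℕ} : Measurable (vand β : (Fin n → ℝ) → ℝ) := by
  unfold vand; fun_prop

lemma continuous_vand (hβ : 0 ≤ β) {n : ℕ} : Continuous (vand β : (Fin n → ℝ) → ℝ) := by
  unfold vand
  refine continuous_finsetProd _ fun j _ => continuous_finsetProd _ fun k _ => ?_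
  exact Continuous.rpow_const (by fun_prop) fun _ => Or.inr hβ

lemma vand_sq {n : ℕ} (T : Fin n → ℝ) :
    vand β T ^ 2 = ∏ i, ∏ k, if k = i then 1 else |T k - T i| ^ β := by
  have h := prod_prod_Ioi_mul_eq_prod_prod_off_diag (fun k i => |T k - T i| ^ β)
  have h2 : ∀ i : Fin n, (∏ k, if k = i then 1 else |T k - T i| ^ β)
      = ∏ k ∈ {i}ᶜ, |T k - T i| ^ β := fun i => by
    rw [← mul_prod_erase univ _ (mem_univ i), if_pos rfl, one_mul]
    refine prod_congr (by ext; simp) fun k hk => if_neg (by simpa using hk)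
  simp_rw [h2, ← h, vand, sq, prod_mul_distrib]
  congr 1
  exact prod_congr rfl fun _ _ => prod_congr rfl fun _ _ => by rw [abs_sub_comm]

lemma vand_succAbove {m : ℕ} (j : Fin (m + 1)) (T : Fin (m + 1) → ℝ) :
    vand β T = (∏ k, |T (j.succAbove k) - T j| ^ β) * vand β (fun k => T (j.succAbove k)) := by
  have h0 : 0 ≤ ∏ k, |T (j.succAbove k) - T j| ^ β :=
    prod_nonneg fun _ _ => Real.rpow_nonneg (abs_nonneg _) _
  refine (sq_eq_sq₀ (vand_nonneg T) (mul_nonneg h0 (vand_nonneg _))).1 ?_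
  rw [mul_pow, vand_sq, vand_sq, Fin.prod_univ_succAbove _ j]
  simp only [Fin.prod_univ_succAbove _ j, if_true, one_mul, Fin.succAbove_ne, if_false,
    (Fin.succAbove_ne _ _).symm, prod_mul_distrib, Fin.succAbove_right_inj]
  rw [← mul_assoc, sq]
  congr 2
  exact prod_congr rfl fun _ _ => by rw [abs_sub_comm]

lemma abs_sub_le_one_add_mul {x y : ℝ} (hx : 0 ≤ x) (hy : 0 ≤ y) :
    |x - y| ≤ (1 + x) * (1 + y) := by
  rw [abs_le]; constructor <;> nlinarith [mul_nonneg hx hy]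

lemma prod_abs_sub_rpow_le (hβ : 0 ≤ β) {m : ℕ} {t : ℝ} {y : Fin m → ℝ} (ht : 0 ≤ t)
    (hy : ∀ i, 0 ≤ y i) :
    ∏ k, |y k - t| ^ β ≤ (1 + t) ^ (β * m) * ∏ k, (1 + y k) ^ β := by
  have h : ∀ k, |y k - t| ^ β ≤ (1 + t) ^ β * (1 + y k) ^ β := fun k => by
    rw [← Real.mul_rpow (by linarith) (by linarith [hy k]), mul_comm]
    exact Real.rpow_le_rpow (abs_nonneg _) (abs_sub_le_one_add_mul (hy k) ht) hβ
  calc ∏ k, |y k - t| ^ β ≤ ∏ k, (1 + t) ^ β * (1 + y k) ^ β :=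
        prod_le_prod (fun _ _ => by positivity) fun k _ => h k
    _ = _ := by
        rw [prod_mul_distrib, prod_const, card_univ, Fintype.card_fin, Real.rpow_mul (by linarith),
          Real.rpow_natCast]

lemma vand_le (hβ : 0 ≤ β) {n : ℕ} {T : Fin n → ℝ} (hT : ∀ i, 0 ≤ T i) :
    vand β T ≤ ∏ i, (1 + T i) ^ (β * (n - 1)) := by
  induction n with
  | zero => simp [vand]
  | succ m ih =>
    have h := ih (T := fun k => T (Fin.succAbove 0 k)) fun _ => hT _
    rw [vand_succAbove 0]
    have h1 := prod_abs_sub_rpow_le hβ (hT 0) (y := fun k => T (Fin.succAbove 0 k)) fun _ => hT _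
    have hp : ∀ i, 0 < 1 + T i := fun i => by linarith [hT i]
    refine (mul_le_mul h1 h (vand_nonneg _) ?_).trans_eq ?_
    · exact mul_nonneg (Real.rpow_nonneg (hp 0).le _)
        (prod_nonneg fun _ _ => Real.rpow_nonneg (hp _).le _)
    · rw [Fin.prod_univ_succAbove _ 0, mul_assoc, ← prod_mul_distrib]
      push_cast
      congr 1
      · ring_nf
      · refine prod_congr rfl fun k _ => ?_
        rw [← Real.rpow_add (hp _)]
        ring_nf

lemma vand_div_sub_le (hβ : 1 ≤ β) {n : ℕ} {T : Fin n → ℝ} (hT : ∀ i, 0 ≤ T i) (j k : Fin n) :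
    |vand β T / (T j - T k)| ≤ (∏ i, (1 + T i) ^ (β * (n - 1))) / (1 + T j) := by
  have hp : ∀ i, 0 < 1 + T i := fun i => by linarith [hT i]
  have hR : 0 ≤ (∏ i, (1 + T i) ^ (β * (n - 1))) / (1 + T j) :=
    div_nonneg (prod_nonneg fun _ _ => Real.rpow_nonneg (hp _).le _) (hp j).le
  rcases eq_or_ne (T j) (T k) with hjk | hjk
  · simpa [hjk] using hR
  obtain ⟨m, rfl⟩ : ∃ m, n = m + 1 := ⟨n - 1, by have := j.pos; omega⟩
  obtain ⟨l, rfl⟩ := Fin.exists_succAbove_eq (x := k) (y := j) (by rintro rfl; exact hjk rfl)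
  have h1 : |T (j.succAbove l) - T j| ^ β / |T j - T (j.succAbove l)|
      ≤ ((1 + T (j.succAbove l)) * (1 + T j)) ^ β / (1 + T j) := by
    have hx : 0 < |T j - T (j.succAbove l)| := abs_pos.2 (sub_ne_zero.2 hjk)
    rw [abs_sub_comm]
    have hA := abs_sub_le_one_add_mul (hT (j.succAbove l)) (hT j)
    rw [abs_sub_comm] at hA
    set A := (1 + T (j.succAbove l)) * (1 + T j) with hAdef
    have hA0 : 0 < A := mul_pos (hp _) (hp _)
    have hAj : 1 + T j ≤ A := by nlinarith [hT j, hT (j.succAbove l), mul_nonneg (hT j) (hT (j.succAbove l))]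
    calc _ = |T j - T (j.succAbove l)| ^ (β - 1) := by rw [Real.rpow_sub_one hx.ne']
      _ ≤ A ^ (β - 1) := Real.rpow_le_rpow hx.le hA (by linarith)
      _ = A ^ β / A := by rw [Real.rpow_sub_one hA0.ne']
      _ ≤ A ^ β / (1 + T j) := div_le_div_of_nonneg_left (by positivity) (hp j) hAj
  have h2 : ∏ i ∈ univ.erase l, |T (j.succAbove i) - T j| ^ β
      ≤ ∏ i ∈ univ.erase l, ((1 + T (j.succAbove i)) * (1 + T j)) ^ β :=
    prod_le_prod (fun _ _ => by positivity) fun i _ => Real.rpow_le_rpow (abs_nonneg _)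
      (abs_sub_le_one_add_mul (hT _) (hT j)) (by linarith)
  have h3 := vand_le (β := β) (by linarith) (T := fun i => T (j.succAbove i)) fun _ => hT _
  have e0 : 0 ≤ ∏ i ∈ univ.erase l, |T (j.succAbove i) - T j| ^ β :=
    prod_nonneg fun _ _ => by positivity
  rw [abs_div, abs_of_nonneg (vand_nonneg T), vand_succAbove j, ← mul_prod_erase univ _ (mem_univ l)]
  have e1 : ∀ i, 0 ≤ (1 + T (j.succAbove i)) * (1 + T j) := fun i => (mul_pos (hp _) (hp _)).le
  calc _ = (|T (j.succAbove l) - T j| ^ β / |T j - T (j.succAbove l)|)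
        * (∏ i ∈ univ.erase l, |T (j.succAbove i) - T j| ^ β)
        * vand β (fun k => T (j.succAbove k)) := by ring
    _ ≤ (((1 + T (j.succAbove l)) * (1 + T j)) ^ β / (1 + T j))
        * (∏ i ∈ univ.erase l, ((1 + T (j.succAbove i)) * (1 + T j)) ^ β)
        * ∏ i, (1 + T (j.succAbove i)) ^ (β * (m - 1)) := by
        have e2 : 0 ≤ ((1 + T (j.succAbove l)) * (1 + T j)) ^ β / (1 + T j) :=
          div_nonneg (Real.rpow_nonneg (e1 l) _) (hp j).le
        refine mul_le_mul (mul_le_mul h1 h2 e0 e2) h3 (vand_nonneg _) (mul_nonneg e2 ?_)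
        exact prod_nonneg fun i _ => Real.rpow_nonneg (e1 i) _
    _ = (∏ i, ((1 + T (j.succAbove i)) * (1 + T j)) ^ β)
        * (∏ i, (1 + T (j.succAbove i)) ^ (β * (m - 1))) / (1 + T j) := by
        rw [← mul_prod_erase univ (fun i => ((1 + T (j.succAbove i)) * (1 + T j)) ^ β) (mem_univ l)]
        ring
    _ = _ := by
        rw [Fin.prod_univ_succAbove _ j]
        simp_rw [Real.mul_rpow (hp _).le (hp j).le]
        rw [prod_mul_distrib, prod_const, card_univ, Fintype.card_fin, ← Real.rpow_natCast,
          ← Real.rpow_mul (hp j).le, mul_comm (∏ i, (1 + T (j.succAbove i)) ^ β), mul_assoc,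
          ← prod_mul_distrib]
        push_cast
        congr 2
        · ring_nf
        · refine prod_congr rfl fun k _ => ?_
          rw [← Real.rpow_add (hp _)]
          ring_nf

lemma hasDerivAt_prod_abs_sub_rpow {m : ℕ} {y : Fin m → ℝ} {t : ℝ} (ht : ∀ k, t ≠ y k) :
    HasDerivAt (fun x => ∏ k, |y k - x| ^ β)
      ((∏ k, |y k - t| ^ β) * ∑ k, β / (t - y k)) t := by
  have h : ∀ k, HasDerivAt (fun x => |y k - x| ^ β) (|y k - t| ^ β * (β / (t - y k))) t := by
    intro k
    have hne : y k - t ≠ 0 := sub_ne_zero.2 (ht k).symm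
    have h1 := ((hasDerivAt_abs hne).comp t ((hasDerivAt_id t).const_sub (y k))).rpow_const
      (p := β) (Or.inl (abs_ne_zero.2 hne))
    refine h1.congr_deriv ?_
    simp only [Function.comp]
    rw [Real.rpow_sub_one (abs_ne_zero.2 hne)]
    have hne' : t - y k ≠ 0 := sub_ne_zero.2 (ht k)
    rcases hne.lt_or_gt with h | h
    · rw [sign_neg h, abs_of_neg h]; simp; field_simp
    · rw [sign_pos h, abs_of_pos h]; simp; field_simp; ring
  refine (HasDerivAt.fun_finsetProd (u := univ) fun k _ => h k).congr_deriv ?_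
  rw [mul_sum]
  refine sum_congr rfl fun k _ => ?_
  rw [smul_eq_mul, ← mul_assoc, prod_erase_mul _ _ (mem_univ k)]

end Vandermonde

section Orthant

variable {β b : ℝ} {n : ℕ}

/-- Lebesgue measure on the positive orthant `(0,∞)^n`, as a product measure. -/
noncomputable def orthantMeasure (n : ℕ) : Measure (Fin n → ℝ) :=
  Measure.pi fun _ => volume.restrict (Set.Ioi 0)

lemma restrict_pi_Ioi_eq_orthantMeasure (n : ℕ) :
    (volume : Measure (Fin n → ℝ)).restrict (Set.univ.pi fun _ => Set.Ioi 0) =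
      orthantMeasure n := by
  rw [volume_pi, Measure.restrict_pi_pi]; rfl

lemma ae_orthantMeasure_pos (n : ℕ) : ∀ᵐ τ ∂orthantMeasure n, ∀ i, 0 < τ i := by
  rw [← restrict_pi_Ioi_eq_orthantMeasure]
  filter_upwards [ae_restrict_mem (MeasurableSet.univ_pi fun _ => measurableSet_Ioi)] with τ hτ i
  exact hτ i (Set.mem_univ i)

lemma wdW_eq (τ : Fin n → ℝ) :
    wdW β b n τ = (∏ j, invGammaWeight (β * n) b (τ j)) * vand β τ := rfl

lemma measurable_wdW : Measurable (wdW β b n) := by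
  have h : ∀ j : Fin n, Measurable fun τ : Fin n → ℝ => invGammaWeight (β * n) b (τ j) :=
    fun j => measurable_invGammaWeight.comp (measurable_pi_apply j)
  exact (measurable_fun_prod _ fun j _ => h j).mul measurable_vand

lemma wdW_nonneg {τ : Fin n → ℝ} (hτ : ∀ i, 0 < τ i) : 0 ≤ wdW β b n τ :=
  mul_nonneg (prod_nonneg fun i _ => (invGammaWeight_pos (hτ i)).le) (vand_nonneg τ)

lemma wdW_eq_zero_of_not_injective (hβ : β ≠ 0) {τ : Fin n → ℝ} (hτ : ¬ Function.Injective τ) :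
    wdW β b n τ = 0 := by
  simp only [Function.Injective, not_forall] at hτ
  obtain ⟨j, k, h, hjk⟩ := hτ
  wlog hlt : j < k generalizing j k
  · exact this k j h.symm (Ne.symm hjk) (lt_of_le_of_ne (not_lt.1 hlt) (Ne.symm hjk))
  have hv : vand β τ = 0 := prod_eq_zero (mem_univ j)
    (prod_eq_zero (mem_Ioi.2 hlt) (by simp [h, Real.zero_rpow hβ]))
  rw [wdW, hv, mul_zero]

/-- A product function dominating the delay time density on the positive orthant. -/
noncomputable def wdEnvelope (β b : ℝ) (n : ℕ) (τ : Fin n → ℝ) : ℝ :=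
  ∏ i, (1 + τ i) ^ (β * (n - 1)) * invGammaWeight (β * n) b (τ i)

lemma wdEnvelope_nonneg {τ : Fin n → ℝ} (hτ : ∀ i, 0 < τ i) : 0 ≤ wdEnvelope β b n τ :=
  prod_nonneg fun i _ => mul_nonneg (Real.rpow_nonneg (by linarith [hτ i]) _)
    (invGammaWeight_pos (hτ i)).le

lemma wdW_le_wdEnvelope (hβ : 0 ≤ β) {τ : Fin n → ℝ} (hτ : ∀ i, 0 < τ i) :
    wdW β b n τ ≤ wdEnvelope β b n τ := by
  rw [wdW_eq, wdEnvelope, prod_mul_distrib, mul_comm]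
  exact mul_le_mul_of_nonneg_right (vand_le hβ fun i => (hτ i).le)
    (prod_nonneg fun i _ => (invGammaWeight_pos (hτ i)).le)

lemma abs_wdW_div_sub_le (hβ : 1 ≤ β) {τ : Fin n → ℝ} (hτ : ∀ i, 0 < τ i) (j k : Fin n) :
    |wdW β b n τ / (τ j - τ k)| ≤ wdEnvelope β b n τ / (1 + τ j) := by
  have h0 : 0 ≤ ∏ j, invGammaWeight (β * n) b (τ j) :=
    prod_nonneg fun i _ => (invGammaWeight_pos (hτ i)).le
  rw [wdW_eq, wdEnvelope, prod_mul_distrib, mul_div_assoc, abs_mul, abs_of_nonneg h0,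
    mul_comm (∏ i, (1 + τ i) ^ (β * ((n : ℝ) - 1))), mul_div_assoc]
  exact mul_le_mul_of_nonneg_left (vand_div_sub_le hβ (fun i => (hτ i).le) j k) h0

lemma one_add_sum_le_prod_one_add {ι : Type*} (s : Finset ι) {f : ι → ℝ} (hf : ∀ i, 0 ≤ f i) :
    1 + ∑ i ∈ s, f i ≤ ∏ i ∈ s, (1 + f i) := by
  classical
  induction s using Finset.induction_on with
  | empty => simp
  | insert i s hi ih =>
    rw [sum_insert hi, prod_insert hi]
    nlinarith [hf i, mul_nonneg (hf i) (sum_nonneg fun k (_ : k ∈ s) => hf k),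
      mul_le_mul_of_nonneg_left ih (hf i)]

lemma integrable_of_abs_le_wdEnvelope (hβ : 1 ≤ β) (hβn : 2 < β * n)
    (hb : b = 3 * β * n / 2 + 2 - β) {f : (Fin n → ℝ) → ℝ} (hf : Measurable f) {K : ℝ}
    (hK : 0 ≤ K)
    (h : ∀ τ, (∀ i, 0 < τ i) → |f τ| ≤ K * ((1 + ∑ i, τ i) ^ 2 * wdEnvelope β b n τ)) :
    Integrable f (orthantMeasure n) := by
  have hn : (1 : ℝ) ≤ n := by
    rcases Nat.eq_zero_or_pos n with rfl | h
    · norm_num at hβn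
    · exact_mod_cast h
  have he : 0 ≤ β * ((n : ℝ) - 1) := mul_nonneg (by linarith) (by linarith)
  have h1 := integrableOn_one_add_rpow_mul_invGammaWeight (κ := β * n) (b := b)
    (e := β * (n - 1) + 2) (by linarith) (by nlinarith) (by linarith) (by rw [hb]; linarith)
  have hD : Integrable (fun τ : Fin n → ℝ =>
      ∏ i, (1 + τ i) ^ (β * (n - 1) + 2) * invGammaWeight (β * n) b (τ i)) (orthantMeasure n) :=
    Integrable.fintype_prod
      (f := fun _ t => (1 + t) ^ (β * ((n : ℝ) - 1) + 2) * invGammaWeight (β * n) b t)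
      fun _ => h1
  refine (hD.const_mul K).mono' hf.aestronglyMeasurable ?_
  filter_upwards [ae_orthantMeasure_pos n] with τ hτ
  refine (h τ hτ).trans (mul_le_mul_of_nonneg_left ?_ hK)
  have hs : 1 + ∑ i, τ i ≤ ∏ i, (1 + τ i) :=
    one_add_sum_le_prod_one_add univ fun i => (hτ i).le
  have hs0 : 0 ≤ ∑ i, τ i := sum_nonneg fun i _ => (hτ i).le
  calc (1 + ∑ i, τ i) ^ 2 * wdEnvelope β b n τ
      ≤ (∏ i, (1 + τ i)) ^ 2 * wdEnvelope β b n τ :=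
        mul_le_mul_of_nonneg_right (pow_le_pow_left₀ (by linarith) hs 2) (wdEnvelope_nonneg hτ)
    _ = _ := by
        rw [wdEnvelope, ← prod_pow, ← prod_mul_distrib]
        refine prod_congr rfl fun i _ => ?_
        rw [Real.rpow_add (by linarith [hτ i]), Real.rpow_two]
        ring

lemma integrable_mul_wdW (hβ : 1 ≤ β) (hβn : 2 < β * n) (hb : b = 3 * β * n / 2 + 2 - β)
    {f : (Fin n → ℝ) → ℝ} (hf : Measurable f) {K : ℝ} (hK : 0 ≤ K)
    (h : ∀ τ, (∀ i, 0 < τ i) → |f τ| ≤ K * (1 + ∑ i, τ i) ^ 2) :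
    Integrable (fun τ => f τ * wdW β b n τ) (orthantMeasure n) := by
  refine integrable_of_abs_le_wdEnvelope hβ hβn hb (hf.mul measurable_wdW) hK fun τ hτ => ?_
  rw [abs_mul, abs_of_nonneg (wdW_nonneg hτ), ← mul_assoc]
  exact mul_le_mul (h τ hτ) (wdW_le_wdEnvelope (by linarith) hτ) (wdW_nonneg hτ) (by positivity)

/-- The affine observable `a₀ + ∑ a_i τ_i`. -/
def affineObs (a₀ : ℝ) (a : Fin n → ℝ) (τ : Fin n → ℝ) : ℝ := a₀ + ∑ i, a i * τ i

lemma measurable_affineObs (a₀ : ℝ) (a : Fin n → ℝ) : Measurable (affineObs a₀ a) := by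
  unfold affineObs; fun_prop

lemma abs_affineObs_le (a₀ : ℝ) (a : Fin n → ℝ) {τ : Fin n → ℝ} (hτ : ∀ i, 0 < τ i) :
    |affineObs a₀ a τ| ≤ (|a₀| + ∑ i, |a i|) * (1 + ∑ i, τ i) := by
  have h1 : |∑ i, a i * τ i| ≤ ∑ i, |a i| * ∑ k, τ k := by
    refine (abs_sum_le_sum_abs _ _).trans (sum_le_sum fun i _ => ?_)
    rw [abs_mul, abs_of_pos (hτ i)]
    exact mul_le_mul_of_nonneg_left (single_le_sum (fun k _ => (hτ k).le) (mem_univ i))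
      (abs_nonneg _)
  rw [← sum_mul] at h1
  have h2 := abs_add_le a₀ (∑ i, a i * τ i)
  have h3 : 0 ≤ |a₀| * ∑ i, τ i := mul_nonneg (abs_nonneg _) (sum_nonneg fun i _ => (hτ i).le)
  have h4 : 0 ≤ ∑ i, |a i| := sum_nonneg fun i _ => abs_nonneg _
  unfold affineObs
  nlinarith

/-- The partial derivative `∂_j (τ_j² (a₀ + ∑ a_i τ_i) W(τ))` of the delay time density `W`. -/
noncomputable def wdFlux (β b : ℝ) (n : ℕ) (a₀ : ℝ) (a : Fin n → ℝ) (j : Fin n)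
    (τ : Fin n → ℝ) : ℝ :=
  (2 * τ j * affineObs a₀ a τ + τ j ^ 2 * a j - b * τ j * affineObs a₀ a τ
      + β * n / 2 * affineObs a₀ a τ) * wdW β b n τ
    + β * ∑ k, τ j ^ 2 * affineObs a₀ a τ * (wdW β b n τ / (τ j - τ k))

lemma integrable_wdFlux (hβ : 1 ≤ β) (hβn : 2 < β * n) (hb : b = 3 * β * n / 2 + 2 - β)
    (a₀ : ℝ) (a : Fin n → ℝ) (j : Fin n) :
    Integrable (wdFlux β b n a₀ a j) (orthantMeasure n) := by
  set A := |a₀| + ∑ i, |a i| with hA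
  have hA0 : 0 ≤ A := add_nonneg (abs_nonneg _) (sum_nonneg fun i _ => abs_nonneg _)
  have hq := measurable_affineObs a₀ a
  have haj : |a j| ≤ A := by
    have := single_le_sum (f := fun i => |a i|) (fun i _ => abs_nonneg _) (mem_univ j)
    have h0 := abs_nonneg a₀
    linarith
  have key : ∀ τ : Fin n → ℝ, (∀ i, 0 < τ i) → 1 ≤ 1 + ∑ i, τ i ∧ τ j ≤ 1 + ∑ i, τ i := by
    intro τ hτ
    have h1 := single_le_sum (f := τ) (fun i _ => (hτ i).le) (mem_univ j)
    have h2 := hτ j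
    constructor <;> linarith
  refine Integrable.add ?_ (Integrable.const_mul (integrable_finsetSum _ fun k _ => ?_) _)
  · refine integrable_mul_wdW hβ hβn hb (by fun_prop) (K := (2 + 1 + |b| + β * n / 2) * A)
      (mul_nonneg (by have := abs_nonneg b; linarith) hA0) fun τ hτ => ?_
    obtain ⟨hs1, hsj⟩ := key τ hτ
    have hQ := abs_affineObs_le a₀ a hτ
    rw [← hA] at hQ
    set s := 1 + ∑ i, τ i
    set q := affineObs a₀ a τ
    have hj := hτ j
    have e1 : |τ j * q| ≤ A * s ^ 2 := by
      rw [abs_mul, abs_of_pos hj]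
      nlinarith [mul_le_mul hsj hQ (abs_nonneg q) (by linarith)]
    have e2 : |τ j ^ 2 * a j| ≤ A * s ^ 2 := by
      rw [abs_mul, abs_of_pos (by positivity : 0 < τ j ^ 2)]
      nlinarith [mul_le_mul (pow_le_pow_left₀ hj.le hsj 2) haj (abs_nonneg _) (by positivity)]
    have e3 : |q| ≤ A * s ^ 2 := hQ.trans (by
      refine mul_le_mul_of_nonneg_left ?_ hA0
      nlinarith)
    calc _ = |2 * (τ j * q) + τ j ^ 2 * a j + (-b) * (τ j * q) + β * n / 2 * q| := by
          congr 1; ring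
      _ ≤ |2 * (τ j * q)| + |τ j ^ 2 * a j| + |(-b) * (τ j * q)| + |β * n / 2 * q| :=
          (abs_add_le _ _).trans (by gcongr; exact abs_add_three _ _ _)
      _ = 2 * |τ j * q| + |τ j ^ 2 * a j| + |b| * |τ j * q| + β * n / 2 * |q| := by
          rw [abs_mul 2, abs_mul (-b), abs_mul (β * n / 2), abs_neg, abs_two,
            abs_of_pos (by linarith : 0 < β * n / 2)]
      _ ≤ 2 * (A * s ^ 2) + A * s ^ 2 + |b| * (A * s ^ 2) + β * n / 2 * (A * s ^ 2) := by
          gcongr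
      _ = _ := by ring
  · refine integrable_of_abs_le_wdEnvelope hβ hβn hb ?_ hA0 fun τ hτ => ?_
    · have := measurable_wdW (β := β) (b := b) (n := n)
      fun_prop
    obtain ⟨hs1, hsj⟩ := key τ hτ
    have hQ := abs_affineObs_le a₀ a hτ
    rw [← hA] at hQ
    have hW := abs_wdW_div_sub_le (b := b) hβ hτ j k
    have hE := wdEnvelope_nonneg (β := β) (b := b) hτ
    have hj := hτ j
    set s := 1 + ∑ i, τ i
    rw [abs_mul, abs_mul, abs_of_pos (by positivity : 0 < τ j ^ 2)]
    calc _ ≤ τ j ^ 2 * (A * s) * (wdEnvelope β b n τ / (1 + τ j)) := by gcongr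
      _ = A * s * wdEnvelope β b n τ * (τ j ^ 2 / (1 + τ j)) := by ring
      _ ≤ A * s * wdEnvelope β b n τ * s := by
          gcongr
          rw [div_le_iff₀ (by linarith)]
          nlinarith
      _ = _ := by ring

lemma integral_slice_wdFlux {m : ℕ} (hβ : 1 ≤ β) (hβn : 2 < β * (m + 1 : ℕ))
    (hb : b = 3 * β * (m + 1 : ℕ) / 2 + 2 - β) (a₀ : ℝ) (a : Fin (m + 1) → ℝ) (j : Fin (m + 1))
    {y : Fin m → ℝ} (hy : ∀ i, 0 < y i)
    (hi : IntegrableOn (fun t => wdFlux β b (m + 1) a₀ a j (j.insertNth t y)) (Set.Ioi 0)) :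
    ∫ t in Set.Ioi 0, wdFlux β b (m + 1) a₀ a j (j.insertNth t y) = 0 := by
  set κ : ℝ := β * (m + 1 : ℕ) with hκ
  have hκ' : κ = β * m + β := by rw [hκ]; push_cast; ring
  have hbm : b = β * m + κ / 2 + 2 := by rw [hb, hκ']; push_cast; ring
  have hbm0 : 0 ≤ β * m := by positivity
  set r : ℝ := a₀ + ∑ k, a (j.succAbove k) * y k with hr
  obtain ⟨C, hC⟩ : ∃ C, C = (∏ k, invGammaWeight κ b (y k)) * vand β y := ⟨_, rfl⟩
  have hq : ∀ t, affineObs a₀ a (j.insertNth t y) = r + a j * t := fun t => by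
    simp only [affineObs, Fin.sum_univ_succAbove _ j, Fin.insertNth_apply_same,
      Fin.insertNth_apply_succAbove, hr]
    ring
  have hW : ∀ t, wdW β b (m + 1) (j.insertNth t y)
      = C * (invGammaWeight κ b t * ∏ k, |y k - t| ^ β) := fun t => by
    rw [wdW_eq, vand_succAbove j, Fin.prod_univ_succAbove _ j]
    simp only [Fin.insertNth_apply_same, Fin.insertNth_apply_succAbove, hC, ← hκ]
    ring
  have hcP : Continuous fun t => ∏ k, |y k - t| ^ β :=
    continuous_finsetProd _ fun k _ => Continuous.rpow_const (by fun_prop)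
      fun _ => Or.inr (by linarith)
  refine integral_Ioi_deriv_eq_zero_off_countable (s := Set.range y)
    (f := fun t => C * ((t ^ 2 * (r + a j * t)) * (invGammaWeight κ b t * ∏ k, |y k - t| ^ β)))
    (Set.countable_range y) ?_ (by simp) ?_ hi ?_
  · exact continuousOn_const.mul (ContinuousOn.mul (by fun_prop)
      ((continuousOn_invGammaWeight (by linarith) (by linarith)).mul hcP.continuousOn))
  · rintro t ⟨ht, hty⟩
    have ht : 0 < t := ht
    have hne : ∀ k, t ≠ y k := fun k hk => hty ⟨k, hk.symm⟩
    have h1 : HasDerivAt (fun t => t ^ 2 * (r + a j * t)) (2 * t * (r + a j * t) + t ^ 2 * a j) t := by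
      have := (hasDerivAt_pow 2 t).mul (((hasDerivAt_id t).const_mul (a j)).const_add r)
      refine this.congr_deriv ?_
      simp
    have h2 := (h1.mul ((hasDerivAt_invGammaWeight (κ := κ) (b := b) ht).mul
      (hasDerivAt_prod_abs_sub_rpow (β := β) hne))).const_mul C
    refine h2.congr_deriv ?_
    rw [Pi.mul_apply]
    rw [wdFlux, Fin.sum_univ_succAbove _ j]
    simp only [Fin.insertNth_apply_same, Fin.insertNth_apply_succAbove, hq, hW, sub_self, div_zero,
      mul_zero, zero_add, ← hκ]
    set P := ∏ k, |y k - t| ^ β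
    set w := invGammaWeight κ b t
    have hS : ∑ k, t ^ 2 * (r + a j * t) * (C * (w * P) / (t - y k))
        = t ^ 2 * (r + a j * t) * (C * (w * P)) * ∑ k, 1 / (t - y k) := by
      rw [mul_sum]; exact sum_congr rfl fun k _ => by ring
    have hS' : ∑ k, β / (t - y k) = β * ∑ k, 1 / (t - y k) := by
      rw [mul_sum]; exact sum_congr rfl fun k _ => by ring
    rw [hS, hS']
    field_simp
    ring
  · have h := (tendsto_one_add_rpow_mul_invGammaWeight (κ := κ) (b := b) (e := 3 + β * m)
      (by linarith) (by linarith) (by linarith)).const_mul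
        (|C| * ((|r| + |a j|) * ∏ k, (1 + y k) ^ β))
    rw [mul_zero] at h
    refine squeeze_zero_norm' ?_ h
    filter_upwards [Filter.eventually_gt_atTop 0] with t ht
    have hw := invGammaWeight_pos (κ := κ) (b := b) ht
    have hP := prod_abs_sub_rpow_le (β := β) (by linarith) ht.le (fun k => (hy k).le)
    have hP0 : 0 ≤ ∏ k, |y k - t| ^ β := prod_nonneg fun k _ => by positivity
    have hlin : |t ^ 2 * (r + a j * t)| ≤ (1 + t) ^ 3 * (|r| + |a j|) := by
      have h1 : |r + a j * t| ≤ (1 + t) * (|r| + |a j|) := by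
        refine (abs_add_le _ _).trans ?_
        rw [abs_mul, abs_of_pos ht]
        nlinarith [abs_nonneg r, abs_nonneg (a j), mul_nonneg (abs_nonneg r) ht.le]
      rw [abs_mul, abs_of_pos (by positivity : 0 < t ^ 2)]
      calc _ ≤ (1 + t) ^ 2 * ((1 + t) * (|r| + |a j|)) := by
            gcongr
            linarith
        _ = _ := by ring
    rw [Real.norm_eq_abs, abs_mul, abs_mul, abs_mul (invGammaWeight κ b t), abs_of_pos hw, abs_of_nonneg hP0]
    calc _ ≤ |C| * ((1 + t) ^ 3 * (|r| + |a j|)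
          * (invGammaWeight κ b t * ((1 + t) ^ (β * m) * ∏ k, (1 + y k) ^ β))) := by gcongr
      _ = _ := by
          rw [Real.rpow_add (by linarith)]
          norm_cast
          ring

lemma integral_wdFlux (hβ : 1 ≤ β) (hβn : 2 < β * n) (hb : b = 3 * β * n / 2 + 2 - β)
    (a₀ : ℝ) (a : Fin n → ℝ) (j : Fin n) :
    ∫ τ, wdFlux β b n a₀ a j τ ∂orthantMeasure n = 0 := by
  obtain ⟨m, rfl⟩ : ∃ m, n = m + 1 := ⟨n - 1, by have := j.pos; omega⟩
  have hmp := (measurePreserving_piFinSuccAbove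
    (fun _ : Fin (m + 1) => (volume : Measure ℝ).restrict (Set.Ioi 0)) j).symm
  have hint : Integrable (fun z : ℝ × (Fin m → ℝ) =>
      wdFlux β b (m + 1) a₀ a j (j.insertNth z.1 z.2))
      (((volume : Measure ℝ).restrict (Set.Ioi 0)).prod (orthantMeasure m)) :=
    (hmp.integrable_comp_emb (MeasurableEquiv.measurableEmbedding _)).2
      (integrable_wdFlux hβ hβn hb a₀ a j)
  have heq := hmp.integral_comp (MeasurableEquiv.measurableEmbedding _)
    (wdFlux β b (m + 1) a₀ a j)
  rw [orthantMeasure, ← heq]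
  change ∫ z : ℝ × (Fin m → ℝ), wdFlux β b (m + 1) a₀ a j (j.insertNth z.1 z.2)
    ∂(((volume : Measure ℝ).restrict (Set.Ioi 0)).prod (orthantMeasure m)) = 0
  have : SigmaFinite (orthantMeasure m) := by unfold orthantMeasure; infer_instance
  rw [integral_prod_symm _ hint]
  refine integral_eq_zero_of_ae ?_
  filter_upwards [ae_orthantMeasure_pos m, hint.prod_left_ae] with y hy hi
  exact integral_slice_wdFlux hβ hβn hb a₀ a j hy hi

lemma integral_wdW_ne_zero (hβ : 1 ≤ β) (hβn : 2 < β * n) (hb : b = 3 * β * n / 2 + 2 - β) :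
    ∫ τ, wdW β b n τ ∂orthantMeasure n ≠ 0 := by
  intro h0
  have hi : Integrable (wdW β b n) (orthantMeasure n) := by
    have := integrable_mul_wdW hβ hβn hb (f := fun _ => 1) measurable_const zero_le_one
      (fun τ hτ => by
        have : 0 ≤ ∑ i, τ i := sum_nonneg fun i _ => (hτ i).le
        rw [abs_one, one_mul]
        nlinarith)
    simpa using this
  rw [integral_eq_zero_iff_of_nonneg_ae ((ae_orthantMeasure_pos n).mono fun τ => wdW_nonneg) hi,
    ← restrict_pi_Ioi_eq_orthantMeasure] at h0
  have hc : ContinuousOn (wdW β b n) (Set.univ.pi fun _ => Set.Ioi 0) := by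
    refine ContinuousOn.mul (continuousOn_finsetProd _ fun i _ => ?_)
      (continuous_vand (by linarith)).continuousOn
    intro τ hτ
    have h := (hasDerivAt_invGammaWeight (κ := β * n) (b := b) (hτ i (Set.mem_univ i))).continuousAt
    exact (h.comp (f := fun τ : Fin n → ℝ => τ i) (continuous_apply i).continuousAt).continuousWithinAt
  have h1 := Measure.eqOn_open_of_ae_eq h0
    (isOpen_set_pi Set.finite_univ fun _ _ => isOpen_Ioi) hc continuousOn_const
  have hpos : ∀ i : Fin n, (0 : ℝ) < (i : ℕ) + 1 := fun i => by positivity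
  have h2 := h1 (x := fun i : Fin n => ((i : ℕ) : ℝ) + 1) fun i _ => hpos i
  refine absurd h2 (ne_of_gt (mul_pos (prod_pos fun i _ => invGammaWeight_pos (hpos i)) ?_))
  refine prod_pos fun i _ => prod_pos fun k hk => Real.rpow_pos_of_pos (abs_pos.2 ?_) _
  have hik : i < k := mem_Ioi.1 hk
  have : ((i : ℕ) : ℝ) < (k : ℕ) := by exact_mod_cast hik
  intro h
  linarith

end Orthant

section LoopEquations

variable {n : ℕ} {τ : Fin n → ℝ}

lemma sum_sum_div_sub_eq_half (f : Fin n → ℝ) :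
    ∑ j, ∑ k, f j / (τ j - τ k) = 1 / 2 * ∑ j, ∑ k, (f j - f k) / (τ j - τ k) := by
  have h : ∑ j, ∑ k, f k / (τ j - τ k) = -∑ j, ∑ k, f j / (τ j - τ k) := by
    rw [sum_comm, ← sum_neg_distrib]
    refine sum_congr rfl fun j _ => ?_
    rw [← sum_neg_distrib]
    refine sum_congr rfl fun k _ => ?_
    rw [← div_neg, neg_sub]
  simp_rw [sub_div, sum_sub_distrib, h]
  ring

lemma sum_sum_sq_div_sub (hτ : Function.Injective τ) :
    ∑ j, ∑ k, τ j ^ 2 / (τ j - τ k) = (n - 1) * ∑ j, τ j := by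
  have h : ∀ j k, (τ j ^ 2 - τ k ^ 2) / (τ j - τ k)
      = τ j + τ k - if j = k then 2 * τ j else 0 := fun j k => by
    split_ifs with hjk
    · subst hjk; simp; ring
    · have := sub_ne_zero.2 (hτ.ne hjk)
      field_simp
      ring
  rw [sum_sum_div_sub_eq_half fun j => τ j ^ 2]
  simp only [h, sum_sub_distrib, sum_add_distrib, sum_const, card_univ, Fintype.card_fin,
    sum_ite_eq, mem_univ, if_true, nsmul_eq_mul, ← mul_sum]
  ring

lemma sum_sum_cube_div_sub (hτ : Function.Injective τ) :
    ∑ j, ∑ k, τ j ^ 3 / (τ j - τ k)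
      = (n - 1) * ∑ j, τ j ^ 2 + ((∑ j, τ j) ^ 2 - ∑ j, τ j ^ 2) / 2 := by
  have h : ∀ j k, (τ j ^ 3 - τ k ^ 3) / (τ j - τ k)
      = τ j ^ 2 + τ j * τ k + τ k ^ 2 - if j = k then 3 * τ j ^ 2 else 0 := fun j k => by
    split_ifs with hjk
    · subst hjk; simp; ring
    · have := sub_ne_zero.2 (hτ.ne hjk)
      field_simp
      ring
  rw [sum_sum_div_sub_eq_half fun j => τ j ^ 3]
  simp only [h, sum_sub_distrib, sum_add_distrib, sum_const, card_univ, Fintype.card_fin,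
    sum_ite_eq, mem_univ, if_true, nsmul_eq_mul, ← mul_sum, ← sum_mul]
  ring

variable {β b : ℝ}

lemma sum_wdFlux_eq (a₀ : Fin n → ℝ) (a : Fin n → Fin n → ℝ) (q : Fin n → ℝ)
    (hq : ∀ j, affineObs (a₀ j) (a j) τ = q j) :
    ∑ j, wdFlux β b n (a₀ j) (a j) j τ
      = ((2 - b) * (∑ j, τ j * q j) + (∑ j, τ j ^ 2 * a j j) + β * n / 2 * (∑ j, q j)
        + β * ∑ j, ∑ k, τ j ^ 2 * q j / (τ j - τ k)) * wdW β b n τ := by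
  have h : ∀ j, wdFlux β b n (a₀ j) (a j) j τ = ((2 - b) * (τ j * q j) + τ j ^ 2 * a j j
      + β * n / 2 * q j + β * ∑ k, τ j ^ 2 * q j / (τ j - τ k)) * wdW β b n τ := fun j => by
    rw [wdFlux, hq, add_mul _ (β * _), mul_assoc β, sum_mul]
    congr 1
    · ring
    · congr 1
      exact sum_congr rfl fun k _ => by ring
  simp_rw [h, ← sum_mul, sum_add_distrib, ← mul_sum]

lemma sum_wdFlux_one (hβ : β ≠ 0) (hb : b = 3 * β * n / 2 + 2 - β) :
    ∑ j, wdFlux β b n 1 0 j τ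
      = (β * n / 2 * n - β * n / 2 * ∑ j, τ j) * wdW β b n τ := by
  by_cases hτ : Function.Injective τ
  · rw [sum_wdFlux_eq (fun _ => 1) (fun _ => 0) (fun _ => 1) fun _ => by simp [affineObs]]
    simp only [mul_one, Pi.zero_apply, mul_zero, sum_const_zero, sum_const, card_univ,
      Fintype.card_fin, nsmul_eq_mul, sum_sum_sq_div_sub hτ, hb]
    ring
  · rw [sum_wdFlux_eq (fun _ => 1) (fun _ => 0) (fun _ => 1) fun _ => by simp [affineObs],
      wdW_eq_zero_of_not_injective hβ hτ, mul_zero, mul_zero]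

lemma sum_wdFlux_sum (hβ : β ≠ 0) (hb : b = 3 * β * n / 2 + 2 - β) :
    ∑ j, wdFlux β b n 0 1 j τ
      = ((∑ j, τ j ^ 2) + β * n / 2 * n * (∑ j, τ j) - β * n / 2 * (∑ j, τ j) ^ 2)
        * wdW β b n τ := by
  by_cases hτ : Function.Injective τ
  · rw [sum_wdFlux_eq (fun _ => 0) (fun _ => 1) (fun _ => ∑ i, τ i)
      fun _ => by simp [affineObs]]
    have h : ∑ j, ∑ k, τ j ^ 2 * (∑ i, τ i) / (τ j - τ k) = (n - 1) * (∑ j, τ j) * ∑ i, τ i := by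
      simp_rw [← sum_sum_sq_div_sub hτ, sum_mul, div_mul_eq_mul_div]
    simp only [h, ← sum_mul, Pi.one_apply, mul_one, sum_const, card_univ,
      Fintype.card_fin, nsmul_eq_mul, hb]
    ring
  · rw [sum_wdFlux_eq (fun _ => 0) (fun _ => 1) (fun _ => ∑ i, τ i)
      fun _ => by simp [affineObs], wdW_eq_zero_of_not_injective hβ hτ, mul_zero, mul_zero]

lemma sum_wdFlux_single (hβ : β ≠ 0) (hb : b = 3 * β * n / 2 + 2 - β) :
    ∑ j, wdFlux β b n 0 (Pi.single j 1) j τ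
      = (β * n / 2 * (∑ j, τ j) + β / 2 * (∑ j, τ j) ^ 2
        - (β * n / 2 - 1 + β / 2) * ∑ j, τ j ^ 2) * wdW β b n τ := by
  have hq : ∀ j, affineObs 0 (Pi.single j 1) τ = τ j := fun j => by
    simp [affineObs, Pi.single_apply]
  by_cases hτ : Function.Injective τ
  · rw [sum_wdFlux_eq (fun _ => 0) (fun j => Pi.single j 1) τ hq]
    have h : ∑ j, ∑ k, τ j ^ 2 * τ j / (τ j - τ k) = ∑ j, ∑ k, τ j ^ 3 / (τ j - τ k) := by
      simp_rw [← pow_succ]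
    simp only [h, sum_sum_cube_div_sub hτ, Pi.single_eq_same, mul_one, hb, ← sq]
    ring
  · rw [sum_wdFlux_eq (fun _ => 0) (fun j => Pi.single j 1) τ hq,
      wdW_eq_zero_of_not_injective hβ hτ, mul_zero, mul_zero]

lemma integral_sum_wdFlux (hβ : 1 ≤ β) (hβn : 2 < β * n) (hb : b = 3 * β * n / 2 + 2 - β)
    (a₀ : Fin n → ℝ) (a : Fin n → Fin n → ℝ) :
    ∫ τ, ∑ j, wdFlux β b n (a₀ j) (a j) j τ ∂orthantMeasure n = 0 := by
  rw [integral_finsetSum _ fun j _ => integrable_wdFlux hβ hβn hb _ _ j]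
  exact sum_eq_zero fun j _ => integral_wdFlux hβ hβn hb _ _ j

/-- The variance of the Wigner delay time for every real `β ≥ 1` with `β n > 2`. -/
theorem wigner_delay_time_variance_of_one_le (hβ : 1 ≤ β) (hβn : 2 < β * n)
    (hb : b = 3 * β * n / 2 + 2 - β) :
    wdE β b n (fun τ => ((1 / (n : ℝ)) * ∑ j, τ j) ^ 2)
        - (wdE β b n (fun τ => (1 / (n : ℝ)) * ∑ j, τ j)) ^ 2
      = 4 / ((n + 1) * (n * β - 2)) := by
  have hn : (0 : ℝ) < n := by
    by_contra h
    have : (n : ℝ) = 0 := le_antisymm (not_lt.1 h) n.cast_nonneg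
    norm_num [this] at hβn
  have hβ0 : β ≠ 0 := by linarith
  have hs : ∀ τ : Fin n → ℝ, (∀ i, 0 < τ i) → 0 ≤ ∑ i, τ i :=
    fun τ hτ => sum_nonneg fun i _ => (hτ i).le
  have hi0 : Integrable (fun τ => wdW β b n τ) (orthantMeasure n) := by
    have := integrable_mul_wdW hβ hβn hb (f := fun _ => 1) measurable_const zero_le_one
      (fun τ hτ => by rw [abs_one, one_mul]; nlinarith [hs τ hτ])
    simpa using this
  have hi1 := integrable_mul_wdW hβ hβn hb (f := fun τ => ∑ i, τ i) (by fun_prop) zero_le_one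
    (fun τ hτ => by rw [abs_of_nonneg (hs τ hτ), one_mul]; nlinarith [hs τ hτ])
  have hi11 := integrable_mul_wdW hβ hβn hb (f := fun τ => (∑ i, τ i) ^ 2) (by fun_prop)
    zero_le_one
    (fun τ hτ => by rw [abs_of_nonneg (sq_nonneg _), one_mul]; nlinarith [hs τ hτ])
  have hi2 := integrable_mul_wdW hβ hβn hb (f := fun τ => ∑ i, τ i ^ 2) (by fun_prop)
    zero_le_one
    (fun τ hτ => by
      have := sum_sq_le_sq_sum_of_nonneg (s := univ) (f := τ) fun i _ => (hτ i).le
      rw [abs_of_nonneg (sum_nonneg fun _ _ => sq_nonneg _), one_mul]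
      nlinarith [hs τ hτ])
  have hZ := integral_wdW_ne_zero hβ hβn hb
  set Z := ∫ τ, wdW β b n τ ∂orthantMeasure n with hZdef
  set P := ∫ τ, (∑ i, τ i) * wdW β b n τ ∂orthantMeasure n with hP
  set S := ∫ τ, (∑ i, τ i) ^ 2 * wdW β b n τ ∂orthantMeasure n with hS
  set Q := ∫ τ, (∑ i, τ i ^ 2) * wdW β b n τ ∂orthantMeasure n with hQ
  have hlin : ∀ x y z w : ℝ, ∫ τ, (x + y * (∑ i, τ i) + z * (∑ i, τ i) ^ 2
      + w * ∑ i, τ i ^ 2) * wdW β b n τ ∂orthantMeasure n = x * Z + y * P + z * S + w * Q := by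
    intro x y z w
    have h2 : Integrable (fun τ => x * wdW β b n τ + y * ((∑ i, τ i) * wdW β b n τ))
      (orthantMeasure n) := (hi0.const_mul x).add (hi1.const_mul y)
    have h3 : Integrable (fun τ => x * wdW β b n τ + y * ((∑ i, τ i) * wdW β b n τ)
      + z * ((∑ i, τ i) ^ 2 * wdW β b n τ)) (orthantMeasure n) := h2.add (hi11.const_mul z)
    rw [hZdef, hP, hS, hQ, ← integral_const_mul, ← integral_const_mul, ← integral_const_mul,
      ← integral_const_mul, ← integral_add (hi0.const_mul x) (hi1.const_mul y),
      ← integral_add h2 (hi11.const_mul z), ← integral_add h3 (hi2.const_mul w)]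
    exact integral_congr_ae (.of_forall fun τ => by ring)
  have e1 : β * n / 2 * n * Z - β * n / 2 * P = 0 := by
    have h := integral_sum_wdFlux hβ hβn hb (fun _ => 1) fun _ => 0
    simp_rw [sum_wdFlux_one hβ0 hb] at h
    have h' := hlin (β * n / 2 * n) (-(β * n / 2)) 0 0
    simp only [neg_mul, zero_mul, add_zero, ← sub_eq_add_neg] at h'
    linarith
  have e2 : Q + β * n / 2 * n * P - β * n / 2 * S = 0 := by
    have h := integral_sum_wdFlux hβ hβn hb (fun _ => 0) fun _ => 1
    simp_rw [sum_wdFlux_sum hβ0 hb] at h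
    calc _ = 0 * Z + β * n / 2 * n * P + -(β * n / 2) * S + 1 * Q := by ring
      _ = _ := (hlin _ _ _ _).symm
      _ = 0 := (integral_congr_ae (.of_forall fun τ => by ring)).trans h
  have e3 : β * n / 2 * P + β / 2 * S - (β * n / 2 - 1 + β / 2) * Q = 0 := by
    have h := integral_sum_wdFlux hβ hβn hb (fun _ => 0) fun j => Pi.single j 1
    simp_rw [sum_wdFlux_single hβ0 hb] at h
    calc _ = 0 * Z + β * n / 2 * P + β / 2 * S + -(β * n / 2 - 1 + β / 2) * Q := by ring
      _ = _ := (hlin _ _ _ _).symm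
      _ = 0 := (integral_congr_ae (.of_forall fun τ => by ring)).trans h
  have hm1 : ∫ τ, 1 / (n : ℝ) * (∑ j, τ j) * wdW β b n τ ∂orthantMeasure n = 1 / n * P := by
    simp_rw [hP, mul_assoc, integral_const_mul]
  have hm2 : ∫ τ, (1 / (n : ℝ) * (∑ j, τ j)) ^ 2 * wdW β b n τ ∂orthantMeasure n
      = (1 / n) ^ 2 * S := by
    simp_rw [hS, mul_pow, mul_assoc, integral_const_mul]
  rw [wdE, wdE, restrict_pi_Ioi_eq_orthantMeasure, hm1, hm2, ← hZdef]
  have hPZ : P = n * Z := by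
    have : β * n / 2 * (n * Z - P) = 0 := by linarith
    have := (mul_eq_zero.1 this).resolve_left (by linarith)
    linarith
  have hD : (n + 1) * (n * β - 2) * (S - n ^ 2 * Z) = 4 * n ^ 2 * Z := by
    have hQS : Q = β * n / 2 * S - β * n / 2 * n * P := by linarith
    rw [hQS, hPZ] at e3
    have : β * ((n + 1) * (n * β - 2) * (S - n ^ 2 * Z) - 4 * n ^ 2 * Z) = 0 := by
      linear_combination (-4) * e3
    have := (mul_eq_zero.1 this).resolve_left hβ0
    linarith
  have h2 : (n : ℝ) * β - 2 ≠ 0 := by linarith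
  have h1 : (n : ℝ) + 1 ≠ 0 := by linarith
  rw [hPZ]
  field_simp
  linear_combination hD

end LoopEquations

/-- The variance of the Wigner delay time: `K_2^{(β)} = 4/((n+1)(nβ−2))`,
for `β ∈ {1,2,4}` with `βn > 2`. -/
theorem wigner_delay_time_variance
    (β : ℝ) (hβ : β = 1 ∨ β = 2 ∨ β = 4) (n : ℕ) (hn : 1 ≤ n) (hβn : 2 < β * n)
    (b : ℝ) (hb : b = 3 * β * n / 2 + 2 - β) :
    wdE β b n (fun τ => ((1 / (n : ℝ)) * ∑ j, τ j) ^ 2)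
        - (wdE β b n (fun τ => (1 / (n : ℝ)) * ∑ j, τ j)) ^ 2
      = 4 / ((n + 1) * (n * β - 2)) := by
  exact wigner_delay_time_variance_of_one_le (by rcases hβ with rfl | rfl | rfl <;> norm_num)
    hβn hb
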